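/- Let r_X ≥ 2 and d be integers with 0 < d < r_X, and set r_Z := r_X − d. Let β_X ∈ ℂ with Re β_X > −1, let w ∈ ℂ with Re w > −1, and set β_Z := β_X − 1/2 − w; assume Re β_Z > −1. Let T_X > 0, A_X ∈ ℂ, and suppose the complex sequence (a_m) is (T_X, A_X)-scaled aML with respect to (r_X, β_X). Set T_Z := (T_X^{r_X}·r_Z^{r_Z}·d^d / r_X^{r_X})^{1/r_Z} (a positive real number). Then the quantum-Lefschetz-modified sequence b_m := (Γ(1 + d·m + w)/Γ(1 + w))·a_m is (T_Z, A_Z)-scaled aML with respect to (r_Z, β_Z), where A_Z := (2π)^{1/2}·d^(w+1/2)·(r_Z^(β_Z+1/2)/T_Z^(β_Z))·(T_X^(β_X)/r_X^(β_X+1/2))·A_X/Γ(1 + w). -/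

import Mathlib

/-- Complex power of a real number via the real logarithm:
`s ^ w := exp (w * log s)`. -/
noncomputable def cpowR (s : ℝ) (w : ℂ) : ℂ := Complex.exp (w * Real.log s)

/-- A complex sequence `a` is `(T, θ, A)`-scaled asymptotically Mittag-Leffler
with respect to `(r, β)` if
`a m * Γ(1 + r·m + β) / (T^(r·m+β) · exp(i·θ·(r·m+β))) → A` as `m → ∞`. -/
def IsAML (r : ℕ) (β : ℂ) (a : ℕ → ℂ) (T θ : ℝ) (A : ℂ) : Prop :=
  Filter.Tendsto
    (fun m : ℕ => a m * Complex.Gamma (1 + (r : ℂ) * m + β) /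
      (cpowR T ((r : ℂ) * m + β) * Complex.exp (Complex.I * (θ : ℂ) * ((r : ℂ) * m + β))))
    Filter.atTop (nhds A)

open Filter Topology

theorem Complex.prod_range_add_mul_Gamma {s : ℂ} (hs : 0 < s.re) (n : ℕ) :
    (∏ j ∈ Finset.range n, (s + j)) * Complex.Gamma s = Complex.Gamma (s + n) := by
  induction n with
  | zero => simp
  | succ n ih =>
    have hpos : 0 < (s + n).re := by simp; positivity
    have hne : s + n ≠ 0 := fun h => by simp [h] at hpos
    rw [Finset.prod_range_succ, mul_right_comm, ih, mul_comm, ← Complex.Gamma_add_one _ hne]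
    push_cast
    ring_nf

/-- Stirling's formula for the Gamma function along the translates `z + ℕ` of `ℕ`. -/
theorem tendsto_Gamma_nat_add_div_stirling {z : ℂ} (hz : -1 < z.re) :
    Tendsto (fun n : ℕ => Complex.Gamma (1 + n + z) /
      Complex.exp ((n + z + 1 / 2) * Real.log n - n)) atTop (𝓝 (Real.sqrt (2 * Real.pi) : ℂ)) := by
  have hre : 0 < (1 + z).re := by simp; linarith
  have hΓ : Complex.Gamma (1 + z) ≠ 0 := Complex.Gamma_ne_zero_of_re_pos hre
  have hstir : Tendsto (fun n : ℕ => (Stirling.stirlingSeq n : ℂ)) atTop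
      (𝓝 (Real.sqrt Real.pi : ℂ)) :=
    (Complex.continuous_ofReal.tendsto _).comp Stirling.tendsto_stirlingSeq_sqrt_pi
  have hfrac : Tendsto (fun n : ℕ => (n : ℂ) / (n + (1 + z))) atTop (𝓝 1) :=
    tendsto_natCast_div_add_atTop (1 + z)
  have hlim := (((Complex.GammaSeq_tendsto_Gamma (1 + z)).inv₀ hΓ).const_mul
    (Complex.Gamma (1 + z))).mul ((hstir.mul_const (Real.sqrt 2 : ℂ)).mul hfrac)
  have hval : Complex.Gamma (1 + z) * (Complex.Gamma (1 + z))⁻¹ *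
      ((Real.sqrt Real.pi : ℂ) * (Real.sqrt 2 : ℂ) * 1) = (Real.sqrt (2 * Real.pi) : ℂ) := by
    rw [mul_inv_cancel₀ hΓ, Real.sqrt_mul zero_le_two]
    push_cast
    ring
  rw [hval] at hlim
  refine hlim.congr' ?_
  filter_upwards [eventually_ge_atTop 1] with n hn
  have hn0 : (0 : ℝ) < n := by exact_mod_cast hn
  have hnc : (n : ℂ) ≠ 0 := by exact_mod_cast hn0.ne'
  have hpos : 0 < (1 + n + z : ℂ).re := by simp at hre ⊢; linarith
  have hlin : (1 + n + z : ℂ) ≠ 0 := by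
    intro h; rw [h] at hpos; simp at hpos
  have hprod : (∏ j ∈ Finset.range (n + 1), (1 + z + j)) * Complex.Gamma (1 + z)
      = (n + (1 + z)) * Complex.Gamma (1 + n + z) := by
    rw [Complex.prod_range_add_mul_Gamma hre, ← add_assoc (n : ℂ), add_comm (n : ℂ) 1,
      ← Complex.Gamma_add_one _ hlin]
    push_cast
    ring_nf
  have hlog : (n : ℂ) = Complex.exp (Real.log n) := by
    rw [← Complex.ofReal_exp, Real.exp_log hn0, Complex.ofReal_natCast]
  have hpow : (n : ℂ) ^ (1 + z) = Complex.exp ((1 + z) * Real.log n) := by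
    rw [Complex.cpow_def_of_ne_zero hnc, Complex.ofReal_log hn0.le, Complex.ofReal_natCast,
      mul_comm]
  have hsqrt : (Real.sqrt n : ℂ) = Complex.exp (1 / 2 * Real.log n) := by
    rw [Real.sqrt_eq_rpow, Real.rpow_def_of_pos hn0]
    push_cast
    ring_nf
  have hpown : ((n / Real.exp 1 : ℝ) : ℂ) ^ n = Complex.exp (n * Real.log n - n) := by
    have : n / Real.exp 1 = Real.exp (Real.log n - 1) := by
      rw [Real.exp_sub, Real.exp_log hn0]
    rw [this, Complex.ofReal_exp, ← Complex.exp_nat_mul]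
    push_cast
    ring_nf
  have hexp : Complex.exp ((n + z + 1 / 2) * Real.log n - n) * n =
      Complex.exp ((1 + z) * Real.log n) *
        (Complex.exp (1 / 2 * Real.log n) * Complex.exp (n * Real.log n - n)) := by
    trans Complex.exp ((n + z + 1 / 2) * Real.log n - n) * Complex.exp (Real.log n)
    · rw [← hlog]
    · simp only [← Complex.exp_add]
      ring_nf
  have hfact : (n.factorial : ℂ) ≠ 0 := by exact_mod_cast n.factorial_ne_zero
  have hsqrt2 : (Real.sqrt 2 : ℂ) ≠ 0 := by exact_mod_cast (by positivity : Real.sqrt 2 ≠ 0)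
  have hlin' : (n + (1 + z) : ℂ) ≠ 0 := by convert hlin using 1; ring
  have hstirling : (Stirling.stirlingSeq n : ℂ) * Real.sqrt 2 = n.factorial /
      (Complex.exp (1 / 2 * Real.log n) * Complex.exp (n * Real.log n - n)) := by
    rw [Stirling.stirlingSeq, Real.sqrt_mul zero_le_two, ← hsqrt, ← hpown]
    have : (Real.sqrt n : ℂ) ≠ 0 := by exact_mod_cast (Real.sqrt_pos.mpr hn0).ne'
    push_cast
    field_simp
  rw [Complex.GammaSeq, hpow, hstirling, inv_div, mul_div_assoc', mul_comm (Complex.Gamma (1 + z)),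
    hprod]
  rw [eq_div_iff (Complex.exp_ne_zero _)]
  have h₁ := Complex.exp_ne_zero ((1 + z) * Real.log n)
  have h₂ := Complex.exp_ne_zero (1 / 2 * Real.log n)
  have h₃ := Complex.exp_ne_zero (n * Real.log n - n)
  generalize Complex.exp ((n + z + 1 / 2) * Real.log n - n) = e₀ at *
  generalize Complex.exp ((1 + z) * Real.log n) = e₁ at *
  generalize Complex.exp (1 / 2 * Real.log n) = e₂ at *
  generalize Complex.exp (n * Real.log n - n) = e₃ at *
  generalize Complex.Gamma (1 + n + z) = g
  field_simp
  linear_combination g * hexp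

theorem isAML_zero_iff {r : ℕ} {β : ℂ} {a : ℕ → ℂ} {T : ℝ} {A : ℂ} :
    IsAML r β a T 0 A ↔ Tendsto (fun m : ℕ => a m * Complex.Gamma (1 + (r : ℂ) * m + β) /
      Complex.exp (((r : ℂ) * m + β) * Real.log T)) atTop (𝓝 A) := by
  simp [IsAML, cpowR]

/-- Stirling's formula along an arithmetic progression. -/
theorem tendsto_Gamma_mul_add_div_stirling {r : ℕ} (hr : 0 < r) {z : ℂ} (hz : -1 < z.re) :
    Tendsto (fun m : ℕ => Complex.Gamma (1 + (r : ℂ) * m + z) /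
      Complex.exp ((r * m + z + 1 / 2) * (Real.log r + Real.log m) - r * m)) atTop
      (𝓝 (Real.sqrt (2 * Real.pi) : ℂ)) := by
  refine ((tendsto_Gamma_nat_add_div_stirling hz).comp
    (tendsto_id.const_mul_atTop' hr)).congr' ?_
  filter_upwards [eventually_ge_atTop 1] with m hm
  have hlog : Real.log ((r * m : ℕ) : ℝ) = Real.log r + Real.log m := by
    push_cast
    exact Real.log_mul (by positivity) (by positivity)
  simp only [Function.comp, id, hlog]
  push_cast
  rfl

/-- The defining relation of the scale `T_Z`, in logarithmic form. -/
theorem mul_log_scale_eq {rX d rZ : ℕ} (hrX : 0 < rX) (hd : 0 < d) (hrZ : 0 < rZ)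
    {TX : ℝ} (hTX : 0 < TX) :
    (rZ : ℝ) * Real.log
      ((TX ^ rX * (rZ : ℝ) ^ rZ * (d : ℝ) ^ d / (rX : ℝ) ^ rX) ^ ((rZ : ℝ)⁻¹)) =
    rX * Real.log TX + rZ * Real.log rZ + d * Real.log d - rX * Real.log rX := by
  rw [Real.log_rpow (by positivity), mul_inv_cancel_left₀ (by positivity),
    Real.log_div (by positivity) (by positivity), Real.log_mul (by positivity) (by positivity),
    Real.log_mul (by positivity) (by positivity)]
  simp only [Real.log_pow]

theorem stmt16 (rX d rZ : ℕ) (hrX : 2 ≤ rX) (hd : 0 < d) (hdr : d < rX)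
    (hrZ : rZ = rX - d)
    (βX w βZ : ℂ) (hβX : -1 < βX.re) (hw : -1 < w.re)
    (hβZdef : βZ = βX - 1 / 2 - w) (hβZ : -1 < βZ.re)
    (TX : ℝ) (hTX : 0 < TX) (AX : ℂ) (a : ℕ → ℂ)
    (haML : IsAML rX βX a TX 0 AX)
    (TZ : ℝ)
    (hTZ : TZ = (TX ^ rX * (rZ : ℝ) ^ rZ * (d : ℝ) ^ d / (rX : ℝ) ^ rX) ^ ((rZ : ℝ)⁻¹)) :
    IsAML rZ βZ
      (fun m : ℕ => Complex.Gamma (1 + (d : ℂ) * m + w) / Complex.Gamma (1 + w) * a m)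
      TZ 0
      ((Real.sqrt (2 * Real.pi) : ℂ) * cpowR (d : ℝ) (w + 1 / 2) *
        (cpowR (rZ : ℝ) (βZ + 1 / 2) / cpowR TZ βZ) *
        (cpowR TX βX / cpowR (rX : ℝ) (βX + 1 / 2)) * AX / Complex.Gamma (1 + w)) := by
  have hrX0 : 0 < rX := by omega
  have hrZ0 : 0 < rZ := by omega
  have hsum : (rX : ℂ) = rZ + d := by
    have : rX = rZ + d := by omega
    exact_mod_cast this
  have hscale : (rZ : ℂ) * Real.log TZ =
      rX * Real.log TX + rZ * Real.log rZ + d * Real.log d - rX * Real.log rX := by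
    rw [hTZ]
    exact_mod_cast mul_log_scale_eq hrX0 hd hrZ0 hTX
  have hs : (Real.sqrt (2 * Real.pi) : ℂ) ≠ 0 := by
    exact_mod_cast (by positivity : Real.sqrt (2 * Real.pi) ≠ 0)
  rw [isAML_zero_iff] at haML ⊢
  set C : ℂ := Complex.exp ((w + 1 / 2) * Real.log d + (βZ + 1 / 2) * Real.log rZ
    - βZ * Real.log TZ + βX * Real.log TX - (βX + 1 / 2) * Real.log rX) with hC
  have hlim := (((((tendsto_Gamma_mul_add_div_stirling hd hw).mul
    (tendsto_Gamma_mul_add_div_stirling hrZ0 hβZ)).div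
    (tendsto_Gamma_mul_add_div_stirling hrX0 hβX) hs).mul haML).mul_const
    (C / Complex.Gamma (1 + w)))
  convert! hlim.congr' ?_ using 2
  · simp only [cpowR, hC, Complex.exp_add, Complex.exp_sub]
    field_simp
  · filter_upwards with m
    have hpos : 0 < (1 + (rX : ℂ) * m + βX).re := by
      have : (0 : ℝ) ≤ rX * m := by positivity
      simp
      linarith
    have hΓ := Complex.Gamma_ne_zero_of_re_pos hpos
    have hexp : Complex.exp ((d * m + w + 1 / 2) * (Real.log d + Real.log m) - d * m) *
        Complex.exp ((rZ * m + βZ + 1 / 2) * (Real.log rZ + Real.log m) - rZ * m) *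
        Complex.exp ((rX * m + βX) * Real.log TX) =
        C * Complex.exp ((rZ * m + βZ) * Real.log TZ) *
        Complex.exp ((rX * m + βX + 1 / 2) * (Real.log rX + Real.log m) - rX * m) := by
      simp only [hC, ← Complex.exp_add]
      congr 1
      rw [hβZdef]
      linear_combination (-(m : ℂ)) * hscale + (m - m * Real.log m : ℂ) * hsum
    have hΓw : Complex.Gamma (1 + w) ≠ 0 :=
      Complex.Gamma_ne_zero_of_re_pos (by simp; linarith)
    simp only [Pi.div_apply]
    have h₁ := Complex.exp_ne_zero ((d * m + w + 1 / 2) * (Real.log d + Real.log m) - d * m)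
    have h₂ := Complex.exp_ne_zero ((rZ * m + βZ + 1 / 2) * (Real.log rZ + Real.log m) - rZ * m)
    have h₃ := Complex.exp_ne_zero ((rX * m + βX + 1 / 2) * (Real.log rX + Real.log m) - rX * m)
    have h₄ := Complex.exp_ne_zero ((rX * m + βX) * Real.log TX)
    have h₅ := Complex.exp_ne_zero ((rZ * m + βZ) * Real.log TZ)
    clear_value C
    generalize Complex.exp ((d * m + w + 1 / 2) * (Real.log d + Real.log m) - d * m) = e₁ at *
    generalize Complex.exp ((rZ * m + βZ + 1 / 2) * (Real.log rZ + Real.log m) - rZ * m) = e₂ at *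
    generalize Complex.exp ((rX * m + βX + 1 / 2) * (Real.log rX + Real.log m) - rX * m) = e₃ at *
    generalize Complex.exp ((rX * m + βX) * Real.log TX) = e₄ at *
    generalize Complex.exp ((rZ * m + βZ) * Real.log TZ) = e₅ at *
    generalize Complex.Gamma (1 + rX * m + βX) = g₁ at *
    generalize Complex.Gamma (1 + rZ * m + βZ) = g₂
    generalize Complex.Gamma (1 + d * m + w) = g₃
    field_simp
    linear_combination (-(g₃ * g₂ * a m)) * hexp
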